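/- (Theorem 1, ensemble generalization bound — deterministic part) Assume: (i) the loss ε_D is convex in the hypothesis, (ii) for each client k, ε_D(h) ≤ ε_{D_k}(h) + L‖D − D_k‖₁ for all h (domain-shift bound with loss bounded by L), (iii) for each k with probability at least 1 − δ/K, |ε_{D_k}(h_{S_k}) − ε_{S_k}(h_{S_k})| ≤ C√((d + log(K/δ))/m) (uniform convergence), and (iv) the ERM property ε_{S_k}(h_{S_k}) ≤ ε_{S_k}(h) for all h. Then with probability at least 1 − δ, ε_D((1/K)Σ_k h_{S_k}) ≤ ε_Ŝ(h_Ŝ) + C√((d + log(K/δ))/m) + (L/K)·Σ_k ‖D − D_k‖₁, where ε_Ŝ = (1/K)Σ_k ε_{S_k} and h_Ŝ is the pooled ERM. -/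

import Mathlib

open MeasureTheory

/-- Theorem 1 (ensemble generalization bound). Under (i) convexity of the
generalization-error functional ε_D, (ii) the domain-shift bound
ε_D(h) ≤ ε_{D_k}(h) + L‖D − D_k‖₁, (iii) uniform convergence for each client holding
with probability at least 1 − δ/K, and (iv) the local ERM property, with probability
at least 1 − δ the ensemble satisfies
ε_D((1/K)Σ_k h_{S_k}) ≤ ε_Ŝ(h_Ŝ) + C√((d + log(K/δ))/m) + (L/K)Σ_k ‖D − D_k‖₁. -/
theorem stmt_16 {V Ω : Type*} [AddCommGroup V] [Module ℝ V]
    [MeasurableSpace Ω] (ℙ : Measure Ω) [IsProbabilityMeasure ℙ]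
    (K : ℕ) (hK : 0 < K)
    (εD : V → ℝ) (εDk : Fin K → V → ℝ) (εSk : Fin K → Ω → V → ℝ)
    (hS : Fin K → Ω → V) (hPooled : Ω → V)
    (dist : Fin K → ℝ) (L C d m δ : ℝ) (hδ : 0 < δ) (hm : 0 < m)
    (hdist_nonneg : ∀ k, 0 ≤ dist k) (hL : 0 ≤ L)
    (hconvex : ConvexOn ℝ Set.univ εD)
    (hdomain : ∀ k h, εD h ≤ εDk k h + L * dist k)
    (hERM : ∀ k ω h, εSk k ω (hS k ω) ≤ εSk k ω h)
    (hPooledERM : ∀ ω h, (1/K : ℝ) * ∑ k, εSk k ω (hPooled ω) ≤ (1/K : ℝ) * ∑ k, εSk k ω h)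
    (hmeas : ∀ k, MeasurableSet {ω | |εDk k (hS k ω) - εSk k ω (hS k ω)| ≤
      C * Real.sqrt ((d + Real.log (K / δ)) / m)})
    (hunif : ∀ k, ENNReal.ofReal (1 - δ / K) ≤
      ℙ {ω | |εDk k (hS k ω) - εSk k ω (hS k ω)| ≤
        C * Real.sqrt ((d + Real.log (K / δ)) / m)}) :
    ENNReal.ofReal (1 - δ) ≤
      ℙ {ω | εD ((K : ℝ)⁻¹ • ∑ k, hS k ω) ≤
        (1/K : ℝ) * ∑ k, εSk k ω (hPooled ω) +
        C * Real.sqrt ((d + Real.log (K / δ)) / m) +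
        (L / K) * ∑ k, dist k} := by
  set B : ℝ := C * Real.sqrt ((d + Real.log (K / δ)) / m)
  clear_value B
  have hK' : (0 : ℝ) < K := by exact_mod_cast hK
  have hbad : ∀ k, ℙ ({ω | |εDk k (hS k ω) - εSk k ω (hS k ω)| ≤ B}ᶜ) ≤
      ENNReal.ofReal (δ / K) := by
    intro k
    rw [prob_compl_eq_one_sub (hmeas k)]
    refine (tsub_le_tsub_left (hunif k) 1).trans ?_
    rw [tsub_le_iff_right, ← ENNReal.ofReal_one]
    refine le_trans (ENNReal.ofReal_le_ofReal ?_) ENNReal.ofReal_add_le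
    linarith
  have hsub : (⋂ k, {ω | |εDk k (hS k ω) - εSk k ω (hS k ω)| ≤ B}) ⊆
      {ω | εD ((K : ℝ)⁻¹ • ∑ k, hS k ω) ≤
        (1/K : ℝ) * ∑ k, εSk k ω (hPooled ω) + B + (L / K) * ∑ k, dist k} := by
    intro ω hω
    simp only [Set.mem_iInter, Set.mem_ofPred_eq] at hω ⊢
    have hJ : εD (∑ k : Fin K, (K : ℝ)⁻¹ • hS k ω) ≤ ∑ k : Fin K, (K : ℝ)⁻¹ • εD (hS k ω) := by
      apply hconvex.map_sum_le
      · intro i _; positivity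
      · simp [hK'.ne']
      · intro i _; trivial
    rw [← Finset.smul_sum, ← Finset.smul_sum, smul_eq_mul] at hJ
    have hpt : ∑ k, εD (hS k ω) ≤ ∑ k, (εSk k ω (hPooled ω) + B + L * dist k) := by
      apply Finset.sum_le_sum
      intro k _
      have h1 := hdomain k (hS k ω)
      have h2 := hERM k ω (hPooled ω)
      have h3 := (abs_le.mp (hω k)).2
      linarith
    refine hJ.trans ((mul_le_mul_of_nonneg_left hpt (inv_nonneg.mpr hK'.le)).trans_eq ?_)
    rw [Finset.sum_add_distrib, Finset.sum_add_distrib, ← Finset.mul_sum]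
    simp only [Finset.sum_const, Finset.card_univ, Fintype.card_fin, nsmul_eq_mul]
    field_simp
  refine le_trans ?_ (measure_mono hsub)
  have hGm : MeasurableSet (⋂ k, {ω | |εDk k (hS k ω) - εSk k ω (hS k ω)| ≤ B}) :=
    MeasurableSet.iInter hmeas
  have hGc : ℙ ((⋂ k, {ω | |εDk k (hS k ω) - εSk k ω (hS k ω)| ≤ B})ᶜ) ≤ ENNReal.ofReal δ := by
    rw [Set.compl_iInter]
    refine (measure_iUnion_fintype_le ℙ _).trans ((Finset.sum_le_sum fun k _ => hbad k).trans ?_)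
    rw [← ENNReal.ofReal_sum_of_nonneg (fun _ _ => by positivity)]
    apply ENNReal.ofReal_le_ofReal
    simp only [Finset.sum_const, Finset.card_univ, Fintype.card_fin, nsmul_eq_mul]
    exact (mul_div_cancel₀ δ hK'.ne').le
  rw [ENNReal.ofReal_sub _ hδ.le, ENNReal.ofReal_one, tsub_le_iff_right,
    ← prob_add_prob_compl (μ := ℙ) hGm]
  gcongr
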